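/- Let k be a perfect field of characteristic p > 0, let n ≥ 2, s ≥ 1, t ≥ 1 be integers, and let B = (b_{ij}) be a t × s matrix with entries in k[x₁,…,x_n] such that for every nonzero vector b ∈ k^s the vector B·b ∈ k[x₁,…,x_n]^t has at least one entry not lying in k[x₁^p,…,x_n^p]. Then there exists a polynomial g ∈ k[x₁,…,x_{n−1}] such that the matrix B′ over k[x₁,…,x_{n−1}], obtained from B by applying to each entry the substitution x_i ↦ x_i (i ≤ n−1), x_n ↦ g, satisfies: for every nonzero vector b ∈ k^s, the vector B′·b has at least one entry not lying in k[x₁^p,…,x_{n−1}^p]. -/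

import Mathlib

open MvPolynomial

/-- The `k`-submodule `k[x₁^p, …, x_N^p]` of the polynomial ring `k[x₁, …, x_N]`. -/
noncomputable def frobeniusSubmodule (k : Type*) [CommRing k] (p N : ℕ) :
    Submodule k (MvPolynomial (Fin N) k) :=
  Subalgebra.toSubmodule
    (Algebra.adjoin k (Set.range fun i : Fin N => (X i : MvPolynomial (Fin N) k) ^ p))

/-- The substitution homomorphism `k[x₁, …, x_{N+1}] → k[x₁, …, x_N]` sending
`x_i ↦ x_i` for `i ≤ N` and the last variable to `g`. -/
noncomputable def substLast {k : Type*} [CommRing k] {N : ℕ} (g : MvPolynomial (Fin N) k) :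
    MvPolynomial (Fin (N + 1)) k →ₐ[k] MvPolynomial (Fin N) k :=
  aeval (Fin.snoc (fun i : Fin N => (X i : MvPolynomial (Fin N) k)) g)

theorem aux_fwd {k : Type*} [Field k] {p : ℕ} [Fact p.Prime] [CharP k p] {N : ℕ}
    (f : MvPolynomial (Fin N) k) (hf : f ∈ frobeniusSubmodule k p N) (i : Fin N) :
    pderiv i f = 0 := by
  have hf' : f ∈ Algebra.adjoin k
    (Set.range fun i : Fin N => (X i : MvPolynomial (Fin N) k) ^ p) := hf
  induction hf' using Algebra.adjoin_induction with
  | mem x hx =>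
    obtain ⟨j, rfl⟩ := hx
    simp [Derivation.leibniz_pow]
  | algebraMap r => simp [MvPolynomial.algebraMap_eq]
  | add x y hx hy h1 h2 => rw [map_add, h1 hx, h2 hy, add_zero]
  | mul x y hx hy h1 h2 => rw [Derivation.leibniz, h1 hx, h2 hy]; simp

theorem aux_bwd {k : Type*} [Field k] {p : ℕ} [Fact p.Prime] [CharP k p] {N : ℕ}
    (f : MvPolynomial (Fin N) k) (h : ∀ i, pderiv i f = 0) :
    f ∈ frobeniusSubmodule k p N := by
  rw [f.as_sum]
  refine Submodule.sum_mem _ fun m hm => ?_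
  have hdvd : ∀ i, p ∣ m i := by
    intro i
    by_cases h0 : m i = 0
    · simp [h0]
    have h1 := congrArg (coeff (m - Finsupp.single i 1)) (h i)
    rw [coeff_pderiv] at h1
    have h2 : m - Finsupp.single i 1 + Finsupp.single i 1 = m := by
      ext j
      by_cases hj : j = i
      · subst hj; simp; omega
      · simp [Finsupp.single_apply, Ne.symm hj]
    rw [h2] at h1
    have h3 : coeff m f ≠ 0 := by simpa using hm
    have h4 : ((m i : ℕ) : k) = 0 := by
      have : (((m - Finsupp.single i 1 : Fin N →₀ ℕ) i : ℕ) : k) + 1 = (m i : k) := by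
        have := DFunLike.congr_fun h2 i
        rw [← this]; simp
      rw [← this]
      simpa [h3] using h1
    exact (CharP.cast_eq_zero_iff k p _).1 h4
  change monomial m (coeff m f) ∈ Algebra.adjoin k
    (Set.range fun i : Fin N => (X i : MvPolynomial (Fin N) k) ^ p)
  rw [monomial_eq, Finsupp.prod]
  refine Subalgebra.mul_mem _ (Subalgebra.algebraMap_mem _ _) (Subalgebra.prod_mem _ fun i _ => ?_)
  obtain ⟨c, hc⟩ := hdvd i
  rw [hc, pow_mul]
  exact Subalgebra.pow_mem _ (Algebra.subset_adjoin (Set.mem_range_self i)) _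

theorem aux_chain {k : Type*} [Field k] {n : ℕ} (g : MvPolynomial (Fin n) k)
    (f : MvPolynomial (Fin (n + 1)) k) (i : Fin n) :
    pderiv i (substLast g f) = substLast g (pderiv i.castSucc f)
      + pderiv i g * substLast g (pderiv (Fin.last n) f) := by
  induction f using MvPolynomial.induction_on with
  | C a => simp [substLast, MvPolynomial.algebraMap_eq]
  | add a b ha hb => simp only [map_add, ha, hb]; ring
  | mul_X a j ha =>
    simp only [map_mul, Derivation.leibniz, smul_eq_mul, map_add, ha]
    have : pderiv i (substLast g (X j)) = substLast g (pderiv i.castSucc (X j))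
      + pderiv i g * substLast g (pderiv (Fin.last n) (X j)) := by
      refine Fin.lastCases ?_ (fun j => ?_) j
      · simp [substLast, pderiv_X, Pi.single_apply, (Fin.castSucc_lt_last i).ne']
      · simp only [substLast, aeval_X, Fin.snoc_castSucc, pderiv_X, Pi.single_apply]
        by_cases h : j = i <;> simp [h, (Fin.castSucc_lt_last _).ne]
    rw [this]; ring

noncomputable def auxPhi (k : Type*) [Field k] (n : ℕ) :
    MvPolynomial (Fin (n + 1)) k →ₐ[k] Polynomial (MvPolynomial (Fin n) k) :=
  aeval (Fin.snoc (fun i : Fin n => Polynomial.C (X i : MvPolynomial (Fin n) k)) Polynomial.X)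

theorem aux_eval {k : Type*} [Field k] {n : ℕ} (g : MvPolynomial (Fin n) k)
    (f : MvPolynomial (Fin (n + 1)) k) :
    substLast g f = (auxPhi k n f).eval g := by
  induction f using MvPolynomial.induction_on with
  | C a => simp [substLast, auxPhi, MvPolynomial.algebraMap_eq, Polynomial.algebraMap_apply]
  | add a b ha hb => simp only [map_add, ha, hb, Polynomial.eval_add]
  | mul_X a j ha =>
    rw [map_mul, map_mul, Polynomial.eval_mul, ha]
    congr 1
    refine Fin.lastCases ?_ (fun j => ?_) j <;> simp [substLast, auxPhi]

theorem aux_inj {k : Type*} [Field k] {n : ℕ} (f : MvPolynomial (Fin (n + 1)) k)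
    (h : auxPhi k n f = 0) : f = 0 := by
  have : ∀ f, (auxPhi k n f).eval₂ (rename Fin.castSucc : MvPolynomial (Fin n) k →ₐ[k]
      MvPolynomial (Fin (n + 1)) k).toRingHom (X (Fin.last n)) = f := by
    intro f
    induction f using MvPolynomial.induction_on with
    | C a => simp [auxPhi, MvPolynomial.algebraMap_eq, Polynomial.algebraMap_apply]
    | add a b ha hb => simp only [map_add, ha, hb, Polynomial.eval₂_add]
    | mul_X a j ha =>
      rw [map_mul, Polynomial.eval₂_mul, ha]
      congr 1
      refine Fin.lastCases ?_ (fun j => ?_) j <;> simp [auxPhi]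
  rw [← this f, h, Polynomial.eval₂_zero]

theorem aux_zero {k : Type*} [Field k] {n : ℕ} (g : MvPolynomial (Fin n) k) (m : ℕ) :
    ∀ (Q : Polynomial (MvPolynomial (Fin n) k)),
    Q.natDegree ≤ m → (∀ c, (Q.coeff c).totalDegree < g.totalDegree) → Q.eval g = 0 → Q = 0 := by
  have key : ∀ a b : MvPolynomial (Fin n) k, b.totalDegree < g.totalDegree →
      a * g + b = 0 → a = 0 ∧ b = 0 := by
    intro a b hb hab
    have hg : g ≠ 0 := by rintro rfl; simp at hb
    by_cases ha : a = 0
    · subst ha; simpa using hab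
    · exfalso
      have h1 : (a * g).totalDegree = b.totalDegree := by
        rw [eq_neg_of_add_eq_zero_left hab, totalDegree_neg]
      rw [totalDegree_mul_of_isDomain ha hg] at h1
      omega
  induction m with
  | zero =>
    intro Q hQ hd he
    rw [Polynomial.eq_C_of_natDegree_le_zero hQ] at he ⊢
    simpa using he
  | succ m ih =>
    intro Q hQ hd he
    rw [← Polynomial.divX_mul_X_add Q] at he
    simp only [Polynomial.eval_add, Polynomial.eval_mul, Polynomial.eval_X, Polynomial.eval_C] at he
    obtain ⟨h1, h2⟩ := key _ _ (hd 0) he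
    have h3 := ih Q.divX (by rw [Polynomial.natDegree_divX_eq_natDegree_tsub_one]; omega)
      (fun c => by rw [Polynomial.coeff_divX]; exact hd _) h1
    rw [← Polynomial.divX_mul_X_add Q, h3, h2]; simp

theorem aux_main {k : Type*} [Field k] {p : ℕ} [Fact p.Prime] [CharP k p]
    (n D : ℕ) (hn : 1 ≤ n) : ∃ g : MvPolynomial (Fin n) k,
    ∀ f : MvPolynomial (Fin (n + 1)) k,
      (∀ i c, ((auxPhi k n (pderiv i f)).coeff c).totalDegree ≤ D) →
      substLast g f ∈ frobeniusSubmodule k p n → f ∈ frobeniusSubmodule k p (n + 1) := by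
  have hp : 2 ≤ p := (Fact.out : p.Prime).two_le
  let z : Fin n := ⟨0, hn⟩
  set L := D + 1 with hL
  set N := L + 1 + D with hN
  have hpL : D < p * L := by nlinarith
  have hpN : D + p * L + 1 < p * N := by
    have : p * N = p * L + p * (1 + D) := by rw [hN]; ring
    nlinarith
  let g : MvPolynomial (Fin n) k := X z ^ (p * N) + X z ^ (p * L + 1)
  have hg : g.totalDegree = p * N := by
    have := totalDegree_add_eq_left_of_totalDegree_lt
      (p := (X z ^ (p * N) : MvPolynomial (Fin n) k)) (q := X z ^ (p * L + 1))
      (by simp only [totalDegree_X_pow]; omega)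
    rw [this, totalDegree_X_pow]
  have hdg : pderiv z g = X z ^ (p * L) := by
    simp [g, Derivation.leibniz_pow]
  refine ⟨g, fun f hf hm => aux_bwd f ?_⟩
  have h0 := aux_fwd _ hm
  simp only [aux_chain] at h0
  have hz : auxPhi k n (pderiv z.castSucc f) +
      Polynomial.C (X z ^ (p * L)) * auxPhi k n (pderiv (Fin.last n) f) = 0 := by
    apply aux_zero g _ _ le_rfl
    · intro c
      rw [hg, Polynomial.coeff_add, Polynomial.coeff_C_mul]
      refine (totalDegree_add _ _).trans_lt (max_lt ?_ ?_)
      · have := hf z.castSucc c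
        omega
      · refine (totalDegree_mul _ _).trans_lt ?_
        rw [totalDegree_X_pow]
        have := hf (Fin.last n) c
        omega
    · have := h0 z
      rw [hdg, aux_eval, aux_eval] at this
      simpa using this
  have hlast : pderiv (Fin.last n) f = 0 := by
    apply aux_inj
    ext1 c
    have hc := congrArg (fun q => Polynomial.coeff q c) hz
    simp only [Polynomial.coeff_add, Polynomial.coeff_C_mul, Polynomial.coeff_zero] at hc
    rw [Polynomial.coeff_zero]
    by_contra hne
    have h1 := congrArg totalDegree (eq_neg_of_add_eq_zero_left hc)
    rw [totalDegree_neg, totalDegree_mul_of_isDomain (pow_ne_zero _ (X_ne_zero _)) hne,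
      totalDegree_X_pow] at h1
    have := hf z.castSucc c
    omega
  intro i
  refine Fin.lastCases hlast (fun i => ?_) i
  have h1 := h0 i
  rw [hlast, map_zero, mul_zero, add_zero, aux_eval] at h1
  apply aux_inj
  refine aux_zero g _ _ le_rfl (fun c => ?_) h1
  have := hf i.castSucc c
  omega

/-- if `B` is a `t × s` matrix with entries in `k[x₁, …, x_{n+1}]` (with
`n + 1 ≥ 2` variables) such that for every nonzero `b ∈ k^s` some entry of `B·b` lies outside
`k[x₁^p, …, x_{n+1}^p]`, then there is `g ∈ k[x₁, …, x_n]` such that the matrix `B'` obtained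
by applying the substitution `x_i ↦ x_i` (`i ≤ n`), `x_{n+1} ↦ g` to each entry satisfies:
for every nonzero `b ∈ k^s` some entry of `B'·b` lies outside `k[x₁^p, …, x_n^p]`. -/
theorem statement3 {k : Type*} [Field k] {p : ℕ} [Fact p.Prime] [CharP k p] [PerfectField k]
    (n s t : ℕ) (hn : 1 ≤ n) (hs : 1 ≤ s) (ht : 1 ≤ t)
    (B : Matrix (Fin t) (Fin s) (MvPolynomial (Fin (n + 1)) k))
    (hB : ∀ b : Fin s → k, b ≠ 0 →
      ∃ i : Fin t, (∑ j : Fin s, b j • B i j) ∉ frobeniusSubmodule k p (n + 1)) :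
    ∃ g : MvPolynomial (Fin n) k,
      ∀ b : Fin s → k, b ≠ 0 →
        ∃ i : Fin t,
          (∑ j : Fin s, b j • substLast g (B i j)) ∉ frobeniusSubmodule k p n := by
  classical
  have hD : ∃ D : ℕ, ∀ (i : Fin t) (j : Fin s) (l : Fin (n + 1)) (c : ℕ),
      ((auxPhi k n (pderiv l (B i j))).coeff c).totalDegree ≤ D := by
    refine ⟨∑ i, ∑ j, ∑ l, ∑ c ∈ (auxPhi k n (pderiv l (B i j))).support,
      ((auxPhi k n (pderiv l (B i j))).coeff c).totalDegree, fun i j l c => ?_⟩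
    by_cases hc : c ∈ (auxPhi k n (pderiv l (B i j))).support
    · refine le_trans ?_ (Finset.single_le_sum (fun _ _ => Nat.zero_le _) (Finset.mem_univ i))
      refine le_trans ?_ (Finset.single_le_sum (fun _ _ => Nat.zero_le _) (Finset.mem_univ j))
      refine le_trans ?_ (Finset.single_le_sum (fun _ _ => Nat.zero_le _) (Finset.mem_univ l))
      exact Finset.single_le_sum
        (f := fun c => ((auxPhi k n (pderiv l (B i j))).coeff c).totalDegree)
        (fun _ _ => Nat.zero_le _) hc
    · rw [Polynomial.notMem_support_iff.1 hc]; simp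
  obtain ⟨D, hD⟩ := hD
  obtain ⟨g, hg⟩ := aux_main (k := k) (p := p) n D hn
  refine ⟨g, fun b hb => ?_⟩
  obtain ⟨i, hi⟩ := hB b hb
  refine ⟨i, fun hmem => hi (hg _ (fun l c => ?_) ?_)⟩
  · have e : (auxPhi k n (pderiv l (∑ j, b j • B i j))).coeff c =
        ∑ j, b j • (auxPhi k n (pderiv l (B i j))).coeff c := by
      rw [map_sum, map_sum, Polynomial.finsetSum_coeff]
      refine Finset.sum_congr rfl fun j _ => ?_
      rw [Derivation.map_smul, map_smul, Polynomial.coeff_smul]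
    rw [e]
    refine (totalDegree_finsetSum _ _).trans (Finset.sup_le fun j _ => ?_)
    exact (totalDegree_smul_le _ _).trans (hD i j l c)
  · simpa only [map_sum, map_smul] using hmem
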